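/- arXiv:math/0402019 — 7 statements merged into one kernel-verified Lean document; each statement's English description precedes it below -/
import Mathlib

section
/- Let d ≥ 2 and let γ_d denote the standard Gaussian measure on ℝ^d (the product of d copies of N(0,1)). Then the function F(ε) = ∫∫ ⟨x, εx+y⟩ / (‖x‖·‖εx+y‖) dγ_d(x) dγ_d(y) satisfies lim_{ε→0+} F(ε)/ε = ∫∫ (‖x‖²‖y‖² − ⟨x,y⟩²) / (‖x‖·‖y‖³) dγ_d(x) dγ_d(y). Equivalently, if X and Y are independent standard Gaussian vectors in ℝ^d, then E[⟨X, εX+Y⟩/(‖X‖·‖εX+Y‖)] = ε·E[(‖X‖²‖Y‖² − ⟨X,Y⟩²)/(‖X‖·‖Y‖³)] + o(ε) as ε → 0+. -/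
open MeasureTheory ProbabilityTheory Filter Real

section InnerProductSpace

variable {E : Type*} [NormedAddCommGroup E] [InnerProductSpace ℝ E]

lemma norm_inv_norm_smul_sub_le (u : E) {v : E} (hv : v ≠ 0) :
    ‖‖u‖⁻¹ • u - ‖v‖⁻¹ • v‖ ≤ 2 * ‖u - v‖ / ‖v‖ := by
  have hv' : 0 < ‖v‖ := norm_pos_iff.2 hv
  rcases eq_or_ne u 0 with rfl | hu
  · simp only [smul_zero, zero_sub, norm_neg, norm_smul, norm_inv, norm_norm]
    rw [inv_mul_cancel₀ hv'.ne', mul_div_assoc, div_self hv'.ne']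
    norm_num
  have hu' : 0 < ‖u‖ := norm_pos_iff.2 hu
  have key : ‖u‖⁻¹ • u - ‖v‖⁻¹ • v = (‖u‖⁻¹ - ‖v‖⁻¹) • u + ‖v‖⁻¹ • (u - v) := by
    module
  have h : ‖(‖u‖⁻¹ - ‖v‖⁻¹) • u‖ ≤ ‖u - v‖ / ‖v‖ := by
    have : (‖u‖⁻¹ - ‖v‖⁻¹) = (‖v‖ - ‖u‖) / (‖u‖ * ‖v‖) := by field_simp
    rw [norm_smul, this, norm_div, Real.norm_of_nonneg (by positivity : 0 ≤ ‖u‖ * ‖v‖),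
      div_mul_eq_mul_div, mul_comm, mul_div_mul_left _ _ hu'.ne']
    gcongr
    rw [norm_sub_rev u v]
    exact abs_norm_sub_norm_le v u
  calc ‖‖u‖⁻¹ • u - ‖v‖⁻¹ • v‖ ≤ ‖u - v‖ / ‖v‖ + ‖v‖⁻¹ * ‖u - v‖ := by
        rw [key]
        refine (norm_add_le _ _).trans (add_le_add h ?_)
        rw [norm_smul, norm_inv, norm_norm]
    _ = 2 * ‖u - v‖ / ‖v‖ := by ring

lemma abs_inner_div_norm_sub_le (x u : E) {v : E} (hv : v ≠ 0) :
    |inner ℝ x u / (‖x‖ * ‖u‖) - inner ℝ x v / (‖x‖ * ‖v‖)| ≤ 2 * ‖u - v‖ / ‖v‖ := by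
  have key : inner ℝ x u / (‖x‖ * ‖u‖) - inner ℝ x v / (‖x‖ * ‖v‖)
      = inner ℝ (‖x‖⁻¹ • x) (‖u‖⁻¹ • u - ‖v‖⁻¹ • v) := by
    simp only [inner_sub_right, real_inner_smul_left, real_inner_smul_right, div_eq_mul_inv,
      mul_inv]
    ring
  rw [key]
  refine (abs_real_inner_le_norm _ _).trans ?_
  have hx : ‖‖x‖⁻¹ • x‖ ≤ 1 := by
    rw [norm_smul, norm_inv, norm_norm]
    exact inv_mul_le_one
  calc _ ≤ 1 * ‖‖u‖⁻¹ • u - ‖v‖⁻¹ • v‖ := by gcongr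
    _ ≤ _ := by rw [one_mul]; exact norm_inv_norm_smul_sub_le u hv

lemma hasDerivAt_inner_div_norm {x y : E} (hx : x ≠ 0) (hy : y ≠ 0) :
    HasDerivAt (fun t : ℝ => inner ℝ x (t • x + y) / (‖x‖ * ‖t • x + y‖))
      ((‖x‖ ^ 2 * ‖y‖ ^ 2 - inner ℝ x y ^ 2) / (‖x‖ * ‖y‖ ^ 3)) 0 := by
  have hx' : ‖x‖ ≠ 0 := norm_ne_zero_iff.2 hx
  have hy' : ‖y‖ ≠ 0 := norm_ne_zero_iff.2 hy
  have hlin : HasDerivAt (fun t : ℝ => t • x + y) x 0 := by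
    simpa using ((hasDerivAt_id (0 : ℝ)).smul_const x).add_const y
  have hnum : HasDerivAt (fun t : ℝ => inner ℝ x (t • x + y)) (‖x‖ ^ 2) 0 := by
    simpa using (hasDerivAt_const (0 : ℝ) x).inner ℝ hlin
  have hnorm : HasDerivAt (fun t : ℝ => ‖t • x + y‖) (inner ℝ x y / ‖y‖) 0 := by
    have h := hlin.norm_sq.sqrt (by simpa using hy)
    simp only [Real.sqrt_sq (norm_nonneg _), zero_smul, zero_add] at h
    convert h using 1
    rw [real_inner_comm]
    field_simp
  have hmain := hnum.div (hnorm.const_mul ‖x‖) (by simpa using ⟨hx, hy⟩)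
  refine hmain.congr_deriv ?_
  simp only [zero_smul, zero_add]
  field_simp

end InnerProductSpace

lemma integrable_abs_rpow_gaussianReal {s : ℝ} (hs : -1 < s) :
    Integrable (fun t : ℝ => |t| ^ s) (gaussianReal 0 1) := by
  have h1 := integrable_rpow_mul_exp_neg_mul_sq (b := 1 / 2) (by norm_num) hs
  have h2 := h1.comp_neg
  have h3 := (h1.norm.add h2.norm).const_mul (√(2 * π))⁻¹
  rw [gaussianReal_of_var_ne_zero _ one_ne_zero,
    integrable_withDensity_iff_integrable_smul₀' (by fun_prop) (by simp [gaussianPDF])]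
  refine h3.mono' (by fun_prop) (.of_forall fun t => ?_)
  simp only [toReal_gaussianPDF, gaussianPDFReal, smul_eq_mul, norm_mul, Pi.add_apply]
  have e : -(t - 0) ^ 2 / (2 * ((1 : NNReal) : ℝ)) = -(1 / 2) * t ^ 2 := by
    push_cast; ring
  rw [e, neg_sq, NNReal.coe_one, mul_one, mul_assoc, Real.norm_of_nonneg (by positivity)]
  gcongr
  rw [← add_mul, mul_comm]
  gcongr
  rw [Real.norm_of_nonneg (by positivity)]
  rcases abs_cases t with ⟨h, -⟩ | ⟨h, -⟩ <;> rw [h]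
  · exact (le_abs_self _).trans (le_add_of_nonneg_right (norm_nonneg _))
  · exact (le_abs_self _).trans (le_add_of_nonneg_left (norm_nonneg _))

lemma inv_norm_le_rpow_mul_rpow {ι : Type*} [Fintype ι] (y : EuclideanSpace ℝ ι) {i j : ι}
    (hij : i ≠ j) (hi : y i ≠ 0) (hj : y j ≠ 0) :
    ‖y‖⁻¹ ≤ |y i| ^ (-1 / 2 : ℝ) * |y j| ^ (-1 / 2 : ℝ) := by
  classical
  have hi' := abs_pos.2 hi
  have hj' := abs_pos.2 hj
  have hsum : |y i| * |y j| ≤ ‖y‖ ^ 2 := by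
    have h := Finset.sum_le_sum_of_subset_of_nonneg (f := fun k => |y k| ^ 2)
      (Finset.subset_univ {i, j}) (fun _ _ _ => by positivity)
    rw [Finset.sum_pair hij] at h
    rw [EuclideanSpace.norm_sq_eq]
    simp only [Real.norm_eq_abs]
    nlinarith [sq_nonneg (|y i| - |y j|)]
  rw [← Real.mul_rpow hi'.le hj'.le, neg_div, Real.rpow_neg (by positivity),
    ← Real.sqrt_eq_rpow]
  exact inv_anti₀ (Real.sqrt_pos.2 (by positivity)) (Real.sqrt_le_iff.2 ⟨norm_nonneg _, hsum⟩)

lemma ae_pi_gaussianReal_apply_ne_zero {ι : Type*} [Fintype ι] (i : ι) :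
    ∀ᵐ y ∂(Measure.pi fun _ : ι => gaussianReal 0 1), y i ≠ 0 := by
  have h : ∀ᵐ t ∂(gaussianReal 0 1), t ≠ 0 := by
    have := nullSingletonClass_gaussianReal (μ := 0) (v := 1) one_ne_zero
    exact Measure.ae_ne _ 0
  exact (measurePreserving_eval (fun _ : ι => gaussianReal 0 1) i).quasiMeasurePreserving.ae h

lemma integrable_inv_norm_pi_gaussianReal {ι : Type*} [Fintype ι] [Nontrivial ι] :
    Integrable (fun y : ι → ℝ => ‖WithLp.toLp 2 y‖⁻¹)
      (Measure.pi fun _ : ι => gaussianReal 0 1) := by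
  classical
  obtain ⟨i, j, hij⟩ := exists_pair_ne ι
  have hint : Integrable (fun y : ι → ℝ => ∏ k,
      (if k = i ∨ k = j then fun t : ℝ => |t| ^ (-1 / 2 : ℝ) else fun _ => 1) (y k))
      (Measure.pi fun _ : ι => gaussianReal 0 1) := by
    refine Integrable.fintype_prod fun k => ?_
    split_ifs
    · exact integrable_abs_rpow_gaussianReal (by norm_num)
    · exact integrable_const _
  refine hint.mono' (by fun_prop) ?_
  filter_upwards [ae_pi_gaussianReal_apply_ne_zero i, ae_pi_gaussianReal_apply_ne_zero j]
    with y hi hj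
  rw [norm_inv, norm_norm]
  refine (inv_norm_le_rpow_mul_rpow _ hij hi hj).trans_eq ?_
  rw [← Finset.prod_subset (Finset.subset_univ {i, j}), Finset.prod_pair hij]
  · simp
  · intro k _ hk
    simp only [Finset.mem_insert, Finset.mem_singleton] at hk
    simp [hk]

lemma integrable_norm_pi_gaussianReal {ι : Type*} [Fintype ι] :
    Integrable (fun x : ι → ℝ => ‖WithLp.toLp 2 x‖)
      (Measure.pi fun _ : ι => gaussianReal 0 1) := by
  have hint : Integrable (fun x : ι → ℝ => ∑ i, ‖x i‖)
      (Measure.pi fun _ : ι => gaussianReal 0 1) := by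
    refine integrable_finsetSum _ fun i _ => ?_
    have h : Integrable (fun t : ℝ => t) (gaussianReal 0 1) :=
      memLp_one_iff_integrable.1 (memLp_id_gaussianReal 1)
    exact (integrable_comp_eval (μ := fun _ : ι => gaussianReal 0 1) (i := i) h).norm
  refine hint.mono' (by fun_prop) (.of_forall fun x => ?_)
  rw [norm_norm, EuclideanSpace.norm_eq]
  refine Real.sqrt_le_iff.2 ⟨by positivity, ?_⟩
  exact Finset.sum_sq_le_sq_sum_of_nonneg fun i _ => norm_nonneg _

lemma integral_pi_gaussianReal_eq_zero_of_odd {ι : Type*} [Fintype ι] {f : (ι → ℝ) → ℝ}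
    (hf : ∀ y, f (-y) = -f y) : ∫ y, f y ∂(Measure.pi fun _ : ι => gaussianReal 0 1) = 0 := by
  have hmp : MeasurePreserving (fun y : ι → ℝ => -y)
      (Measure.pi fun _ : ι => gaussianReal 0 1) (Measure.pi fun _ : ι => gaussianReal 0 1) := by
    refine measurePreserving_pi (fun _ : ι => gaussianReal 0 1) (fun _ : ι => gaussianReal 0 1)
      (f := fun _ t => -t) fun _ => ⟨measurable_neg, ?_⟩
    rw [gaussianReal_map_neg, neg_zero]
  have h := hmp.integral_comp (MeasurableEquiv.neg (ι → ℝ)).measurableEmbedding f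
  simp only [hf, integral_neg] at h
  linarith

lemma tendsto_integral_inner_div_norm {ι : Type*} [Fintype ι] [Nontrivial ι]
    {γ : Measure (ι → ℝ)} (hγ : γ = Measure.pi fun _ => gaussianReal 0 1) :
    Tendsto (fun ε : ℝ => (∫ x, ∫ y,
        inner ℝ (WithLp.toLp 2 x) (ε • WithLp.toLp 2 x + WithLp.toLp 2 y) /
          (‖WithLp.toLp 2 x‖ * ‖ε • WithLp.toLp 2 x + WithLp.toLp 2 y‖) ∂γ ∂γ) / ε)
      (nhdsWithin 0 (Set.Ioi 0))
      (nhds (∫ x, ∫ y, (‖WithLp.toLp 2 x‖ ^ 2 * ‖WithLp.toLp 2 y‖ ^ 2 -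
          inner ℝ (WithLp.toLp 2 x) (WithLp.toLp 2 y) ^ 2) /
            (‖WithLp.toLp 2 x‖ * ‖WithLp.toLp 2 y‖ ^ 3) ∂γ ∂γ)) := by
  have : IsProbabilityMeasure γ := by rw [hγ]; infer_instance
  let G : ℝ → (ι → ℝ) → (ι → ℝ) → ℝ := fun ε x y =>
    inner ℝ (WithLp.toLp 2 x) (ε • WithLp.toLp 2 x + WithLp.toLp 2 y) /
      (‖WithLp.toLp 2 x‖ * ‖ε • WithLp.toLp 2 x + WithLp.toLp 2 y‖)
  let D : (ι → ℝ) × (ι → ℝ) → ℝ := fun p =>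
    (‖WithLp.toLp 2 p.1‖ ^ 2 * ‖WithLp.toLp 2 p.2‖ ^ 2 -
      inner ℝ (WithLp.toLp 2 p.1) (WithLp.toLp 2 p.2) ^ 2) /
        (‖WithLp.toLp 2 p.1‖ * ‖WithLp.toLp 2 p.2‖ ^ 3)
  let Q : ℝ → (ι → ℝ) × (ι → ℝ) → ℝ := fun ε p => (G ε p.1 p.2 - G 0 p.1 p.2) / ε
  let B : (ι → ℝ) × (ι → ℝ) → ℝ := fun p =>
    2 * (‖WithLp.toLp 2 p.1‖ * ‖WithLp.toLp 2 p.2‖⁻¹)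
  have hGmeas : ∀ ε, Measurable fun p : (ι → ℝ) × (ι → ℝ) => G ε p.1 p.2 := by
    intro ε
    simp only [G]
    fun_prop
  have hQmeas : ∀ ε, Measurable (Q ε) := fun ε =>
    ((hGmeas ε).sub (hGmeas 0)).div_const ε
  have hDmeas : Measurable D := by
    simp only [D]
    fun_prop
  have hB : Integrable B (γ.prod γ) := by
    refine Integrable.const_mul (Integrable.mul_prod (f := fun x => ‖WithLp.toLp 2 x‖)
      (g := fun y => ‖WithLp.toLp 2 y‖⁻¹) ?_ ?_) 2
    · rw [hγ]; exact integrable_norm_pi_gaussianReal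
    · rw [hγ]; exact integrable_inv_norm_pi_gaussianReal
  have hne : ∀ᵐ x ∂γ, WithLp.toLp 2 x ≠ 0 := by
    obtain ⟨i⟩ := (inferInstance : Nonempty ι)
    rw [hγ]
    filter_upwards [ae_pi_gaussianReal_apply_ne_zero i] with y hi h0
    exact hi (congrArg (fun z : EuclideanSpace ℝ ι => z i) h0)
  have hne₁ : ∀ᵐ p ∂γ.prod γ, WithLp.toLp 2 p.1 ≠ 0 :=
    Measure.quasiMeasurePreserving_fst.ae hne
  have hne₂ : ∀ᵐ p ∂γ.prod γ, WithLp.toLp 2 p.2 ≠ 0 :=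
    Measure.quasiMeasurePreserving_snd.ae hne
  have hQB : ∀ ε ∈ Set.Ioi (0 : ℝ), ∀ᵐ p ∂γ.prod γ, ‖Q ε p‖ ≤ B p := by
    intro ε (hε : 0 < ε)
    filter_upwards [hne₂] with p hp
    have h := abs_inner_div_norm_sub_le (WithLp.toLp 2 p.1)
      (ε • WithLp.toLp 2 p.1 + WithLp.toLp 2 p.2) hp
    rw [add_sub_cancel_right, norm_smul, Real.norm_of_nonneg hε.le] at h
    simp only [Q, B, G, zero_smul, zero_add, norm_div, Real.norm_of_nonneg hε.le]
    rw [div_le_iff₀ hε]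
    refine h.trans_eq ?_
    ring
  have hQD : ∀ᵐ p ∂γ.prod γ,
      Tendsto (fun ε => Q ε p) (nhdsWithin 0 (Set.Ioi 0)) (nhds (D p)) := by
    filter_upwards [hne₁, hne₂] with p hp₁ hp₂
    refine ((hasDerivAt_inner_div_norm hp₁ hp₂).tendsto_slope.mono_left
      (nhdsWithin_mono _ fun ε hε => (Set.mem_Ioi.1 hε).ne')).congr fun ε => ?_
    simp only [slope_def_field, sub_zero, Q, G]
  have hDB : ∀ᵐ p ∂γ.prod γ, ‖D p‖ ≤ B p := by
    have hseq : ∀ᵐ p ∂γ.prod γ, ∀ n : ℕ, ‖Q (1 / ((n : ℝ) + 1)) p‖ ≤ B p :=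
      ae_all_iff.2 fun n => hQB _ (Set.mem_Ioi.2 (by positivity))
    filter_upwards [hseq, hQD] with p hp hlim
    refine le_of_tendsto (hlim.comp (tendsto_nhdsWithin_iff.2
      ⟨tendsto_one_div_add_atTop_nhds_zero_nat, .of_forall fun n => ?_⟩)).norm (.of_forall hp)
    exact Set.mem_Ioi.2 (by positivity)
  have hlim : Tendsto (fun ε => ∫ p, Q ε p ∂γ.prod γ) (nhdsWithin 0 (Set.Ioi 0))
      (nhds (∫ p, D p ∂γ.prod γ)) :=
    tendsto_integral_filter_of_dominated_convergence B
      (.of_forall fun ε => (hQmeas ε).aestronglyMeasurable)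
      (eventually_nhdsWithin_of_forall hQB) hB hQD
  rw [integral_prod _ (hB.mono' hDmeas.aestronglyMeasurable hDB)] at hlim
  refine hlim.congr' (eventually_nhdsWithin_of_forall fun ε hε => ?_)
  have hGint : ∀ ε x, Integrable (G ε x) γ := fun ε x =>
    Integrable.of_bound
      ((hGmeas ε).comp (measurable_const.prodMk measurable_id)).aestronglyMeasurable 1
      (.of_forall fun y => abs_real_inner_div_norm_mul_norm_le_one _ _)
  have hG0 : ∀ x, ∫ y, G 0 x y ∂γ = 0 := by
    intro x
    rw [hγ]
    refine integral_pi_gaussianReal_eq_zero_of_odd fun y => ?_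
    simp only [G, zero_smul, zero_add, WithLp.toLp_neg, inner_neg_right, norm_neg, neg_div]
  rw [integral_prod _ (hB.mono' (hQmeas ε).aestronglyMeasurable (hQB ε hε))]
  refine Eq.trans ?_ (integral_div ε _)
  refine integral_congr_ae (.of_forall fun x => ?_)
  simp only [Q]
  rw [integral_div, integral_sub (hGint ε x) (hGint 0 x), hG0, sub_zero]

/-- For `d ≥ 2`, with `γ_d` the standard Gaussian measure on `ℝ^d`,
the function `F(ε) = ∫∫ ⟨x, εx+y⟩ / (‖x‖·‖εx+y‖) dγ_d(x) dγ_d(y)` satisfies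
`lim_{ε→0⁺} F(ε)/ε = ∫∫ (‖x‖²‖y‖² − ⟨x,y⟩²)/(‖x‖·‖y‖³) dγ_d dγ_d`. -/
theorem stmt0 (d : ℕ) (hd : 2 ≤ d)
    (γ : Measure (Fin d → ℝ))
    (hγ : γ = Measure.pi fun _ => gaussianReal 0 1) :
    Tendsto
      (fun ε : ℝ =>
        (∫ x, ∫ y,
            (∑ i, x i * (ε * x i + y i)) /
              (Real.sqrt (∑ i, (x i) ^ 2) *
                Real.sqrt (∑ i, (ε * x i + y i) ^ 2)) ∂γ ∂γ) / ε)
      (nhdsWithin 0 (Set.Ioi 0))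
      (nhds (∫ x, ∫ y,
          ((∑ i, (x i) ^ 2) * (∑ i, (y i) ^ 2) - (∑ i, x i * y i) ^ 2) /
            (Real.sqrt (∑ i, (x i) ^ 2) * Real.sqrt (∑ i, (y i) ^ 2) ^ 3) ∂γ ∂γ)) := by
  have : Nontrivial (Fin d) := Fin.nontrivial_iff_two_le.2 hd
  have hinner : ∀ a b : ℝ, inner ℝ a b = a * b := fun a b => by simp [mul_comm]
  have h := tendsto_integral_inner_div_norm hγ
  simpa only [EuclideanSpace.norm_eq, PiLp.inner_apply, PiLp.add_apply, PiLp.smul_apply,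
    Real.norm_eq_abs, sq_abs, smul_eq_mul, hinner,
    Real.sq_sqrt (Finset.sum_nonneg fun _ _ => sq_nonneg _)] using h
end

section
/- Let d ≥ 2 and let γ_d denote the standard Gaussian measure on ℝ^d. Then the integral C = ∫∫ (‖x‖²‖y‖² − ⟨x,y⟩²) / (‖x‖·‖y‖³) dγ_d(x) dγ_d(y) is finite and strictly positive. -/
open MeasureTheory ProbabilityTheory

/-- `|t| ^ (-1/2)` is integrable with respect to a standard Gaussian. -/
lemma integrable_inv_sqrt_abs_gaussianReal :
    Integrable (fun t : ℝ => (Real.sqrt |t|)⁻¹) (gaussianReal 0 1) := by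
  rw [gaussianReal_of_var_ne_zero _ one_ne_zero,
    integrable_withDensity_iff_integrable_smul' (measurable_gaussianPDF _ _)
      (Filter.Eventually.of_forall fun _ => gaussianPDF_lt_top)]
  have hpos : IntegrableOn
      (fun x : ℝ => (gaussianPDF 0 1 x).toReal • (Real.sqrt |x|)⁻¹) (Set.Ioi 0) := by
    refine IntegrableOn.congr_fun ((integrableOn_rpow_mul_exp_neg_mul_sq (b := 1 / 2) (by norm_num)
      (s := -(1 / 2)) (by norm_num)).const_mul (Real.sqrt (2 * Real.pi))⁻¹)
      (fun x hx => ?_) measurableSet_Ioi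
    have hx : 0 < x := hx
    simp only [toReal_gaussianPDF, gaussianPDFReal, smul_eq_mul, abs_of_pos hx,
      Real.rpow_neg hx.le, ← Real.sqrt_eq_rpow, NNReal.coe_one, sub_zero, mul_one]
    rw [show -x ^ 2 / 2 = -(1 / 2) * x ^ 2 by ring]
    ring
  rw [← integrableOn_univ, ← Set.Iio_union_Ici (a := (0 : ℝ)), integrableOn_union,
    integrableOn_Ici_iff_integrableOn_Ioi]
  refine ⟨?_, hpos⟩
  rw [← (Measure.measurePreserving_neg (volume : Measure ℝ)).integrableOn_comp_preimage
      (Homeomorph.neg ℝ).measurableEmbedding]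
  simpa [Function.comp_def, toReal_gaussianPDF, gaussianPDFReal] using hpos

lemma ae_eval_ne_zero_pi_gaussianReal {ι : Type*} [Fintype ι] (i : ι) :
    ∀ᵐ y : ι → ℝ ∂(Measure.pi fun _ => gaussianReal 0 1), y i ≠ 0 := by
  have : NullSingletonClass (gaussianReal 0 1) := nullSingletonClass_gaussianReal one_ne_zero
  exact (measurePreserving_eval (fun _ : ι => gaussianReal 0 1) i).quasiMeasurePreserving.ae
    (Measure.ae_ne _ 0)

/-- In dimension at least two, the inverse of the Euclidean norm is Gaussian integrable. -/
lemma integrable_inv_sqrt_sum_sq_pi_gaussianReal {ι : Type*} [Fintype ι] [Nontrivial ι] :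
    Integrable (fun y : ι → ℝ => (Real.sqrt (∑ i, (y i) ^ 2))⁻¹)
      (Measure.pi fun _ => gaussianReal 0 1) := by
  classical
  obtain ⟨i, j, hij⟩ := exists_pair_ne ι
  have hprod := Integrable.fintype_prod (μ := fun _ : ι => gaussianReal 0 1)
    (f := fun k t => if k ∈ ({i, j} : Finset ι) then (Real.sqrt |t|)⁻¹ else 1) fun k => by
      by_cases hk : k ∈ ({i, j} : Finset ι)
      · simpa only [hk, if_true] using integrable_inv_sqrt_abs_gaussianReal
      · simpa only [hk, if_false] using integrable_const (1 : ℝ)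
  refine hprod.mono' (Measurable.aestronglyMeasurable (by fun_prop)) ?_
  filter_upwards [ae_eval_ne_zero_pi_gaussianReal i, ae_eval_ne_zero_pi_gaussianReal j]
    with y hi hj
  rw [Finset.prod_ite_mem, Finset.univ_inter, Finset.prod_pair hij,
    Real.norm_of_nonneg (by positivity), ← mul_inv, ← Real.sqrt_mul (abs_nonneg _)]
  have hle : (y i) ^ 2 + (y j) ^ 2 ≤ ∑ k, (y k) ^ 2 := by
    rw [← Finset.sum_pair (f := fun k => (y k) ^ 2) hij]
    exact Finset.sum_le_sum_of_subset_of_nonneg (Finset.subset_univ _)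
      fun _ _ _ => sq_nonneg _
  gcongr
  nlinarith [sq_nonneg (|y i| - |y j|), sq_abs (y i), sq_abs (y j),
    mul_nonneg (abs_nonneg (y i)) (abs_nonneg (y j))]

lemma integrable_sqrt_sum_sq_pi_gaussianReal {ι : Type*} [Fintype ι] :
    Integrable (fun x : ι → ℝ => Real.sqrt (∑ i, (x i) ^ 2))
      (Measure.pi fun _ => gaussianReal 0 1) := by
  have hsum : Integrable (fun x : ι → ℝ => ∑ i, (x i) ^ 2)
      (Measure.pi fun _ => gaussianReal 0 1) :=
    integrable_finsetSum _ fun i _ =>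
      integrable_comp_eval (μ := fun _ : ι => gaussianReal 0 1) (f := fun t => t ^ 2)
        (memLp_id_gaussianReal 2).integrable_sq
  refine ((integrable_const 1).add hsum).mono'
    (Measurable.aestronglyMeasurable (by fun_prop)) (Filter.Eventually.of_forall fun x => ?_)
  have h0 : 0 ≤ ∑ i, (x i) ^ 2 := Finset.sum_nonneg fun _ _ => sq_nonneg _
  rw [Real.norm_of_nonneg (Real.sqrt_nonneg _), Pi.add_apply, Real.sqrt_le_iff]
  constructor <;> nlinarith

/-- For `d ≥ 2`, with `γ_d` the standard Gaussian measure on `ℝ^d`,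
the integral `C = ∫∫ (‖x‖²‖y‖² − ⟨x,y⟩²)/(‖x‖·‖y‖³) dγ_d(x) dγ_d(y)` is finite
(the integrand is integrable on the product) and strictly positive. -/
theorem stmt1 (d : ℕ) (hd : 2 ≤ d)
    (γ : Measure (Fin d → ℝ))
    (hγ : γ = Measure.pi fun _ => gaussianReal 0 1) :
    Integrable
        (fun p : (Fin d → ℝ) × (Fin d → ℝ) =>
          ((∑ i, (p.1 i) ^ 2) * (∑ i, (p.2 i) ^ 2) - (∑ i, p.1 i * p.2 i) ^ 2) /
            (Real.sqrt (∑ i, (p.1 i) ^ 2) * Real.sqrt (∑ i, (p.2 i) ^ 2) ^ 3))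
        (γ.prod γ) ∧
      0 < ∫ p : (Fin d → ℝ) × (Fin d → ℝ),
          ((∑ i, (p.1 i) ^ 2) * (∑ i, (p.2 i) ^ 2) - (∑ i, p.1 i * p.2 i) ^ 2) /
            (Real.sqrt (∑ i, (p.1 i) ^ 2) * Real.sqrt (∑ i, (p.2 i) ^ 2) ^ 3)
          ∂(γ.prod γ) := by
  subst hγ
  have : Nontrivial (Fin d) := Fin.nontrivial_iff_two_le.2 hd
  have : (gaussianReal 0 1).IsOpenPosMeasure :=
    (gaussianReal_absolutelyContinuous' 0 one_ne_zero).isOpenPosMeasure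
  have : (Measure.pi fun _ : Fin d => gaussianReal 0 1).IsOpenPosMeasure :=
    Measure.pi.isOpenPosMeasure _
  have hN (p : (Fin d → ℝ) × (Fin d → ℝ)) :
      0 ≤ (∑ i, (p.1 i) ^ 2) * (∑ i, (p.2 i) ^ 2) - (∑ i, p.1 i * p.2 i) ^ 2 :=
    sub_nonneg.2 (Finset.sum_mul_sq_le_sq_mul_sq _ _ _)
  have hsq (x : Fin d → ℝ) : 0 ≤ ∑ i, (x i) ^ 2 := Finset.sum_nonneg fun _ _ => sq_nonneg _
  have hnonneg (p : (Fin d → ℝ) × (Fin d → ℝ)) :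
      0 ≤ ((∑ i, (p.1 i) ^ 2) * (∑ i, (p.2 i) ^ 2) - (∑ i, p.1 i * p.2 i) ^ 2) /
        (Real.sqrt (∑ i, (p.1 i) ^ 2) * Real.sqrt (∑ i, (p.2 i) ^ 2) ^ 3) :=
    div_nonneg (hN p) (by positivity)
  refine and_iff_left_of_imp (fun hint => ?_) |>.2 ?_
  · rw [integral_pos_iff_support_of_nonneg hnonneg hint]
    let U : Set ((Fin d → ℝ) × (Fin d → ℝ)) := {p |
      0 < (∑ i, (p.1 i) ^ 2) * (∑ i, (p.2 i) ^ 2) - (∑ i, p.1 i * p.2 i) ^ 2}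
    have hU : IsOpen U := isOpen_lt continuous_const (by fun_prop)
    have hne : U.Nonempty := by
      obtain ⟨i, j, hij⟩ := exists_pair_ne (Fin d)
      refine ⟨(Pi.single i 1, Pi.single j 1), ?_⟩
      simp [U, Pi.single_apply, hij.symm]
    refine (hU.measure_pos _ hne).trans_le (measure_mono fun p hp => ?_)
    have hp : 0 < (∑ i, (p.1 i) ^ 2) * (∑ i, (p.2 i) ^ 2) - (∑ i, p.1 i * p.2 i) ^ 2 := hp
    have hmul : 0 < (∑ i, (p.1 i) ^ 2) * (∑ i, (p.2 i) ^ 2) := by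
      nlinarith [sq_nonneg (∑ i, p.1 i * p.2 i)]
    have h1 := pos_of_mul_pos_left hmul (hsq p.2)
    have h2 := pos_of_mul_pos_right hmul (hsq p.1)
    exact (div_pos hp (by positivity)).ne'
  · refine (integrable_sqrt_sum_sq_pi_gaussianReal.mul_prod
      integrable_inv_sqrt_sum_sq_pi_gaussianReal).mono'
      (Measurable.aestronglyMeasurable (by fun_prop)) (Filter.Eventually.of_forall fun p => ?_)
    rw [Real.norm_of_nonneg (hnonneg p)]
    have ha := Real.sq_sqrt (hsq p.1)
    have hb := Real.sq_sqrt (hsq p.2)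
    refine (div_le_div_of_nonneg_right (sub_le_self _ (sq_nonneg _)) (by positivity)).trans ?_
    rw [← ha, ← hb, Real.sqrt_sq (Real.sqrt_nonneg _), Real.sqrt_sq (Real.sqrt_nonneg _)]
    rcases (Real.sqrt_nonneg (∑ i, (p.1 i) ^ 2)).eq_or_lt with h | h
    · simp [← h]
    rcases (Real.sqrt_nonneg (∑ i, (p.2 i) ^ 2)).eq_or_lt with h' | h'
    · simp [← h']
    · apply le_of_eq
      field_simp
end

section
/- For v > 0 let p_v : ℝ → ℝ denote the Gaussian heat kernel p_v(x) = (2πv)^{−1/2} exp(−x²/(2v)). Then for all ε > 0, σ > 0 and every m ∈ ℕ, ∫_ℝ (d^m/dx^m p_ε)(z) dμ(z) = (d^m/dx^m p_{ε+σ²})(0), where μ is the Gaussian measure N(0,σ²) on ℝ. That is, if Z ~ N(0,σ²), then E[p_ε^{(m)}(Z)] = p_{ε+σ²}^{(m)}(0). -/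
open MeasureTheory ProbabilityTheory

/-- The Gaussian heat kernel `p_v(x) = (2πv)^{-1/2} exp(-x²/(2v))`. -/
noncomputable def heatKer (v : ℝ) : ℝ → ℝ :=
  fun x => (2 * Real.pi * v) ^ (-(1 : ℝ) / 2) * Real.exp (-x ^ 2 / (2 * v))

theorem exists_iteratedDeriv_heatKer (v : ℝ) (m : ℕ) :
    ∃ P : Polynomial ℝ, iteratedDeriv m (heatKer v) =
      fun x => P.eval x * Real.exp (-x ^ 2 / (2 * v)) := by
  induction m with
  | zero => exact ⟨Polynomial.C ((2 * Real.pi * v) ^ (-(1 : ℝ) / 2)), by simp; rfl⟩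
  | succ m ih =>
    obtain ⟨P, hP⟩ := ih
    refine ⟨P.derivative - Polynomial.C v⁻¹ * Polynomial.X * P, ?_⟩
    funext x
    rw [iteratedDeriv_succ, hP]
    have h : HasDerivAt (fun y : ℝ => Real.exp (-y ^ 2 / (2 * v)))
        (Real.exp (-x ^ 2 / (2 * v)) * (-(2 * x) / (2 * v))) x := by
      simpa using (((hasDerivAt_id x).pow 2).neg.div_const (2 * v)).exp
    have h2 : -(2 * x) / (2 * v) = -(v⁻¹ * x) := by
      rw [neg_div, mul_div_mul_left _ _ two_ne_zero]; ring
    rw [((P.hasDerivAt x).fun_mul h).deriv, h2]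
    simp only [Polynomial.eval_sub, Polynomial.eval_mul, Polynomial.eval_C, Polynomial.eval_X]
    ring

theorem Polynomial.exists_abs_eval_le_mul_exp (P : Polynomial ℝ) :
    ∃ C : ℝ, 0 ≤ C ∧ ∀ x, |P.eval x| ≤ C * Real.exp |x| := by
  induction P using Polynomial.induction_on' with
  | add p q hp hq =>
    obtain ⟨C, hC, hp⟩ := hp
    obtain ⟨D, hD, hq⟩ := hq
    refine ⟨C + D, add_nonneg hC hD, fun x => ?_⟩
    rw [Polynomial.eval_add, add_mul]
    exact (abs_add_le _ _).trans (add_le_add (hp x) (hq x))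
  | monomial n a =>
    refine ⟨|a| * n.factorial, by positivity, fun x => ?_⟩
    have h := Real.pow_div_factorial_le_exp |x| (abs_nonneg x) n
    rw [div_le_iff₀ (by positivity)] at h
    rw [Polynomial.eval_monomial, abs_mul, abs_pow, mul_assoc, mul_comm (n.factorial : ℝ)]
    gcongr

theorem exists_norm_iteratedDeriv_heatKer_le {v : ℝ} (hv : 0 < v) (m : ℕ) :
    ∃ C : ℝ, ∀ x, ‖iteratedDeriv m (heatKer v) x‖ ≤ C := by
  obtain ⟨P, hP⟩ := exists_iteratedDeriv_heatKer v m
  obtain ⟨C, hC, h⟩ := P.exists_abs_eval_le_mul_exp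
  refine ⟨C * Real.exp (v / 2), fun x => ?_⟩
  rw [hP, Real.norm_eq_abs, abs_mul, Real.abs_exp]
  calc |P.eval x| * Real.exp (-x ^ 2 / (2 * v))
      ≤ C * Real.exp |x| * Real.exp (-x ^ 2 / (2 * v)) := by gcongr; exact h x
    _ = C * Real.exp (|x| + -x ^ 2 / (2 * v)) := by rw [mul_assoc, Real.exp_add]
    _ ≤ C * Real.exp (v / 2) := by
      gcongr
      have : v / 2 - (|x| + -x ^ 2 / (2 * v)) = (|x| - v) ^ 2 / (2 * v) := by
        rw [← sq_abs x]; field_simp; ring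
      have : 0 ≤ (|x| - v) ^ 2 / (2 * v) := by positivity
      linarith

theorem contDiff_heatKer (v : ℝ) : ContDiff ℝ ⊤ (heatKer v) := by
  unfold heatKer
  fun_prop

/-- Derivatives commute with averaging over translations by a finite measure, as long as all of
them are bounded. -/
theorem iteratedDeriv_integral_comp_add_of_bounded {f : ℝ → ℝ} (hf : ContDiff ℝ ⊤ f)
    (hb : ∀ m : ℕ, ∃ C : ℝ, ∀ x, ‖iteratedDeriv m f x‖ ≤ C) (μ : Measure ℝ) [IsFiniteMeasure μ]
    (m : ℕ) :
    iteratedDeriv m (fun x => ∫ z, f (x + z) ∂μ) =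
      fun x => ∫ z, iteratedDeriv m f (x + z) ∂μ := by
  have hc (m : ℕ) : Continuous (iteratedDeriv m f) := hf.continuous_iteratedDeriv m (by simp)
  induction m with
  | zero => simp
  | succ m ih =>
    funext x
    rw [iteratedDeriv_succ, ih]
    obtain ⟨C, hC⟩ := hb (m + 1)
    obtain ⟨D, hD⟩ := hb m
    have hmeas (k : ℕ) (y : ℝ) :
        AEStronglyMeasurable (fun z => iteratedDeriv k f (y + z)) μ :=
      ((hc k).comp (by fun_prop : Continuous fun z : ℝ => y + z)).aestronglyMeasurable
    refine (hasDerivAt_integral_of_dominated_loc_of_deriv_le (bound := fun _ => C)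
      (F' := fun y z => iteratedDeriv (m + 1) f (y + z)) Filter.univ_mem
      (.of_forall fun y => hmeas m y)
      (.of_bound (hmeas m x) D (.of_forall fun z => hD _)) (hmeas (m + 1) x)
      (.of_forall fun z y _ => hC _) (integrable_const C)
      (.of_forall fun z y _ => ?_)).2.deriv
    have hd : Differentiable ℝ (iteratedDeriv m f) :=
      hf.differentiable_iteratedDeriv m (by exact_mod_cast WithTop.coe_lt_top _)
    have h := (hd (y + z)).hasDerivAt
    rw [← iteratedDeriv_succ] at h
    exact h.comp_add_const y z

theorem heatKer_eq_inv_sqrt_mul {v : ℝ} (hv : 0 < v) (x : ℝ) :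
    heatKer v x = (√(2 * Real.pi * v))⁻¹ * Real.exp (-x ^ 2 / (2 * v)) := by
  rw [heatKer, Real.sqrt_eq_rpow, ← Real.rpow_neg (by positivity)]
  norm_num

/-- The semigroup property of the heat kernel. -/
theorem integral_heatKer_add_gaussianReal {ε : ℝ} (hε : 0 < ε) {v : NNReal} (hv : 0 < v)
    (x : ℝ) :
    ∫ z, heatKer ε (x + z) ∂(gaussianReal 0 v) = heatKer (ε + v) x := by
  have hv' : (0 : ℝ) < v := hv
  lift ε to NNReal using hε.le
  have hε' : 0 < ε := hε
  have hw : 0 < ε * v / (ε + v) := by positivity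
  rw [integral_gaussianReal_eq_integral_smul hv.ne']
  have key (z : ℝ) : gaussianPDFReal 0 v z • heatKer ε (x + z) =
      heatKer (ε + v) x * gaussianPDFReal (-(v * x / (ε + v))) (ε * v / (ε + v)) z := by
    rw [heatKer_eq_inv_sqrt_mul hε, heatKer_eq_inv_sqrt_mul (by positivity), gaussianPDFReal,
      gaussianPDFReal, smul_eq_mul, mul_mul_mul_comm (√(2 * Real.pi * v))⁻¹,
      mul_mul_mul_comm (√(2 * Real.pi * (ε + v)))⁻¹, ← Real.exp_add, ← Real.exp_add, ← mul_inv, ← mul_inv, ← Real.sqrt_mul (by positivity),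
      ← Real.sqrt_mul (by positivity)]
    push_cast
    congr 2
    · congr 1; field_simp
    · field_simp; ring
  simp_rw [key]
  rw [integral_const_mul, integral_gaussianPDFReal_eq_one _ hw.ne', mul_one]

theorem integral_iteratedDeriv_heatKer_gaussianReal {ε : ℝ} (hε : 0 < ε) {v : NNReal}
    (hv : 0 < v) (m : ℕ) :
    ∫ z, iteratedDeriv m (heatKer ε) z ∂(gaussianReal 0 v) =
      iteratedDeriv m (heatKer (ε + v)) 0 := by
  have h := iteratedDeriv_integral_comp_add_of_bounded (contDiff_heatKer ε)
    (exists_norm_iteratedDeriv_heatKer_le hε) (gaussianReal 0 v) m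
  rw [funext (integral_heatKer_add_gaussianReal hε hv)] at h
  simpa using (congrFun h 0).symm

/-- If `Z ~ N(0,σ²)` then `E[p_ε^{(m)}(Z)] = p_{ε+σ²}^{(m)}(0)`
for all `ε > 0`, `σ > 0` and `m ∈ ℕ`. -/
theorem stmt4 (ε σ : ℝ) (hε : 0 < ε) (hσ : 0 < σ) (m : ℕ) :
    (∫ z, iteratedDeriv m (heatKer ε) z
        ∂(gaussianReal 0 ⟨σ ^ 2, sq_nonneg σ⟩))
      = iteratedDeriv m (heatKer (ε + σ ^ 2)) 0 := by
  exact integral_iteratedDeriv_heatKer_gaussianReal hε (v := ⟨σ ^ 2, sq_nonneg σ⟩)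
    (pow_pos hσ 2) m
end

section
/- Let H ∈ (0,1) and let 0 < s < t. Then t^{2H} + s^{2H} − (t−s)^{2H} < 2·(st)^H. Equivalently, the fractional Brownian motion covariance R_H(s,t) = ½(s^{2H} + t^{2H} − |t−s|^{2H}) satisfies the strict Cauchy–Schwarz inequality R_H(s,t) < s^H t^H for s ≠ t, so that (st)^{2H} − R_H(s,t)² > 0. -/
/-- Strict subadditivity of `x ↦ x ^ p` on the positive reals for `p < 1`. -/
theorem Real.rpow_add_lt_add_rpow {a b p : ℝ} (ha : 0 < a) (hb : 0 < b) (hp : p < 1) :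
    (a + b) ^ p < a ^ p + b ^ p := by
  have key : ∀ x : ℝ, 0 < x → x ^ p = x * x ^ (p - 1) := fun x hx => by
    rw [Real.rpow_sub_one hx.ne', mul_div_cancel₀ _ hx.ne']
  rw [key _ (add_pos ha hb), key a ha, key b hb, add_mul]
  have h1 := Real.rpow_lt_rpow_of_neg ha (lt_add_of_pos_right a hb) (sub_neg.2 hp)
  have h2 := Real.rpow_lt_rpow_of_neg hb (lt_add_of_pos_left b ha) (sub_neg.2 hp)
  gcongr

/-- For `H ∈ (0,1)` and `0 < s < t`,
`t^{2H} + s^{2H} − (t−s)^{2H} < 2(st)^H`, i.e. the fBm covariance satisfies the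
strict Cauchy–Schwarz inequality. -/
theorem stmt7 (H s t : ℝ) (hH : H ∈ Set.Ioo (0 : ℝ) 1) (hs : 0 < s) (hst : s < t) :
    t ^ (2 * H) + s ^ (2 * H) - (t - s) ^ (2 * H) < 2 * (s * t) ^ H := by
  have ht : 0 < t := hs.trans hst
  have sq : ∀ x : ℝ, 0 < x → x ^ (2 * H) = (x ^ H) ^ 2 := fun x hx => by
    rw [two_mul, Real.rpow_add hx, _root_.sq]
  rw [sq t ht, sq s hs, sq _ (sub_pos.2 hst), Real.mul_rpow hs.le ht.le]
  have h1 := Real.rpow_add_lt_add_rpow hs (sub_pos.2 hst) hH.2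
  rw [add_sub_cancel] at h1
  have h2 := Real.rpow_lt_rpow hs.le hst hH.1
  nlinarith [pow_lt_pow_left₀ (sub_lt_iff_lt_add'.2 h1) (sub_nonneg.2 h2.le) two_ne_zero]
end

section
/- Let H ∈ (1/2, 1) and a > 0. Then there exists a constant C > 0 such that for every integer n ≥ a + 2, ∫_a^{a+1} ∫_n^{n+1} (v−u)^{2H−2} · (u^{2H} + v^{2H} − (v−u)^{2H}) · (uv)^{−H} dv du ≤ C · n^{3H−3}. (This is the upper estimate on the covariance term a_n showing the process ∫_0^t sign(B_s) dB_s is not long-range dependent for H < 2/3.) -/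
/-- Convexity bound for the increment of `x ↦ x ^ p` with `1 ≤ p ≤ 2`. -/
lemma rpow_add_rpow_sub_rpow_le {p u v : ℝ} (hp1 : 1 ≤ p) (hp2 : p ≤ 2) (hu : 0 < u)
    (huv : u ≤ v) : u ^ p + v ^ p - (v - u) ^ p ≤ 3 * u * v ^ (p - 1) := by
  have hv : 0 < v := hu.trans_le huv
  have hsplit : ∀ x : ℝ, 0 < x → x ^ p = x * x ^ (p - 1) := fun x hx => by
    rw [Real.rpow_sub_one hx.ne']; field_simp
  have hmono : u ^ (p - 1) ≤ v ^ (p - 1) := Real.rpow_le_rpow hu.le huv (by linarith)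
  have hle : u / v ≤ 1 := (div_le_one hv).2 huv
  have bernoulli : 1 + p * (-(u / v)) ≤ (1 + -(u / v)) ^ p :=
    one_add_mul_self_le_rpow_one_add (by linarith) hp1
  have hfactor : (v - u) ^ p = v ^ p * (1 + -(u / v)) ^ p := by
    rw [← Real.mul_rpow hv.le (by linarith)]
    congr 1
    field_simp
    ring
  have hvp : 0 < v ^ (p - 1) := Real.rpow_pos_of_pos hv _
  have hlower : v ^ p * (1 + p * (-(u / v))) ≤ (v - u) ^ p := by
    rw [hfactor]
    exact mul_le_mul_of_nonneg_left bernoulli (Real.rpow_nonneg hv.le _)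
  have hexpand : v ^ p * (1 + p * (-(u / v))) = v ^ p - p * (u * v ^ (p - 1)) := by
    rw [hsplit v hv]; field_simp; ring
  have hu_le : u ^ p ≤ u * v ^ (p - 1) := by
    rw [hsplit u hu]
    exact mul_le_mul_of_nonneg_left hmono hu.le
  have hp_le : p * (u * v ^ (p - 1)) ≤ 2 * (u * v ^ (p - 1)) :=
    mul_le_mul_of_nonneg_right hp2 (by positivity)
  linarith

lemma norm_covariance_integrand_le {H a N u v : ℝ} (hH1 : 1 / 2 < H) (hH2 : H < 1) (ha : 0 < a)
    (hN : a + 2 ≤ N) (hu1 : a < u) (hu2 : u ≤ a + 1) (hv : N < v) :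
    ‖(v - u) ^ (2 * H - 2) * (u ^ (2 * H) + v ^ (2 * H) - (v - u) ^ (2 * H)) * (u * v) ^ (-H)‖ ≤
      3 * (a + 1) ^ (1 - H) * ((a + 2)⁻¹) ^ (2 * H - 2) * N ^ (3 * H - 3) := by
  have hu : 0 < u := ha.trans hu1
  have hN0 : 0 < N := by linarith
  have hv0 : 0 < v := hN0.trans hv
  have hvu : 0 < v - u := by linarith
  have hmid0 : 0 ≤ u ^ (2 * H) + v ^ (2 * H) - (v - u) ^ (2 * H) := by
    have h1 : (v - u) ^ (2 * H) ≤ v ^ (2 * H) :=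
      Real.rpow_le_rpow hvu.le (by linarith) (by linarith)
    have h2 := Real.rpow_nonneg hu.le (2 * H)
    linarith
  have hmid := rpow_add_rpow_sub_rpow_le (p := 2 * H) (by linarith) (by linarith) hu
    (by linarith : u ≤ v)
  have hdist : (a + 2)⁻¹ * N ≤ v - u := by
    rw [inv_mul_le_iff₀ (by linarith)]
    nlinarith
  have hfirst : (v - u) ^ (2 * H - 2) ≤ ((a + 2)⁻¹) ^ (2 * H - 2) * N ^ (2 * H - 2) := by
    rw [← Real.mul_rpow (by positivity) hN0.le]
    exact Real.rpow_le_rpow_of_nonpos (by positivity) hdist (by linarith)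
  have hlast : 3 * u * v ^ (2 * H - 1) * (u * v) ^ (-H) ≤
      3 * (a + 1) ^ (1 - H) * N ^ (H - 1) := by
    have hu_eq : u * u ^ (-H) = u ^ (1 - H) := by
      rw [sub_eq_add_neg, Real.rpow_add hu, Real.rpow_one]
    have hv_eq : v ^ (2 * H - 1) * v ^ (-H) = v ^ (H - 1) := by
      rw [← Real.rpow_add hv0]; congr 1; ring
    have heq : 3 * u * v ^ (2 * H - 1) * (u * v) ^ (-H) = 3 * u ^ (1 - H) * v ^ (H - 1) := by
      rw [Real.mul_rpow hu.le hv0.le, ← hu_eq, ← hv_eq]; ring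
    have h1 : u ^ (1 - H) ≤ (a + 1) ^ (1 - H) := Real.rpow_le_rpow hu.le hu2 (by linarith)
    have h2 : v ^ (H - 1) ≤ N ^ (H - 1) :=
      Real.rpow_le_rpow_of_nonpos hN0 hv.le (by linarith)
    rw [heq]
    gcongr
  have hN_eq : N ^ (3 * H - 3) = N ^ (2 * H - 2) * N ^ (H - 1) := by
    rw [← Real.rpow_add hN0]; congr 1; ring
  rw [Real.norm_of_nonneg (by positivity)]
  calc _ ≤ (v - u) ^ (2 * H - 2) * (3 * u * v ^ (2 * H - 1)) * (u * v) ^ (-H) := by gcongr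
    _ = (v - u) ^ (2 * H - 2) * (3 * u * v ^ (2 * H - 1) * (u * v) ^ (-H)) := by ring
    _ ≤ (((a + 2)⁻¹) ^ (2 * H - 2) * N ^ (2 * H - 2)) *
          (3 * (a + 1) ^ (1 - H) * N ^ (H - 1)) := by gcongr
    _ = _ := by rw [hN_eq]; ring


/-- For `H ∈ (1/2,1)` and `a > 0` there is `C > 0` such that for
every integer `n ≥ a + 2`,
`∫_a^{a+1} ∫_n^{n+1} (v−u)^{2H−2}(u^{2H}+v^{2H}−(v−u)^{2H})(uv)^{−H} dv du ≤ C n^{3H−3}`. -/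
theorem stmt9 (H a : ℝ) (hH : H ∈ Set.Ioo (1 / 2 : ℝ) 1) (ha : 0 < a) :
    ∃ C : ℝ, 0 < C ∧ ∀ n : ℕ, a + 2 ≤ (n : ℝ) →
      (∫ u in a..(a + 1), ∫ v in (n : ℝ)..((n : ℝ) + 1),
          (v - u) ^ (2 * H - 2) *
            (u ^ (2 * H) + v ^ (2 * H) - (v - u) ^ (2 * H)) *
              (u * v) ^ (-H))
        ≤ C * (n : ℝ) ^ (3 * H - 3) := by
  obtain ⟨hH1, hH2⟩ := hH
  refine ⟨3 * (a + 1) ^ (1 - H) * ((a + 2)⁻¹) ^ (2 * H - 2), by positivity, fun n hn => ?_⟩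
  refine (Real.le_norm_self _).trans
    ((intervalIntegral.norm_integral_le_of_norm_le_const fun u hu => ?_).trans_eq
      (by rw [add_sub_cancel_left, abs_one, mul_one]))
  rw [Set.uIoc_of_le (by linarith)] at hu
  refine (intervalIntegral.norm_integral_le_of_norm_le_const fun v hv => ?_).trans_eq
    (by rw [add_sub_cancel_left, abs_one, mul_one])
  rw [Set.uIoc_of_le (by linarith)] at hv
  exact norm_covariance_integrand_le hH1 hH2 ha hn hu.1 hu.2 hv.1
end

section
/- Let H ∈ (1/2, 1) and a > 0. Then there exists a constant C > 0 such that for every integer n ≥ a + 2, ∫_a^{a+1} ∫_n^{n+1} (s^{2H−1} + (t−s)^{2H−1}) · (t^{2H−1} − (t−s)^{2H−1}) · ((st)^{2H} − ¼(t^{2H} + s^{2H} − (t−s)^{2H})²)^{−1/2} dt ds ≤ C · n^{3H−3}. (This is the estimate on the local-time term b_n in the proof that ∫_0^t sign(B_s) dB_s is not long-range dependent for H < 2/3.) -/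
open Real in
/-- The normalised covariance determinant of fractional Brownian motion at times `x` and `1` is
bounded below by a multiple of `x ^ (2 * H)`, uniformly for `x` away from `1`. -/
lemma mul_rpow_le_fbm_det_one {H q x : ℝ} (hH0 : 0 < H) (hH1 : H < 1) (hq : q < 1)
    (hx : 0 < x) (hxq : x ≤ q) :
    (1 / 2) * (1 - q ^ (1 - H)) * (1 - q) ^ H * x ^ (2 * H) ≤
      x ^ (2 * H) - (1 / 4) * (1 + x ^ (2 * H) - (1 - x) ^ (2 * H)) ^ 2 := by
  have h1x : 0 < 1 - x := by linarith
  have hq0 : 0 < q := hx.trans_le hxq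
  have sq_rpow (y : ℝ) (hy : 0 < y) : y ^ (2 * H) = (y ^ H) ^ 2 := by
    rw [mul_comm, rpow_mul hy.le, rpow_two]
  rw [sq_rpow x hx, sq_rpow (1 - x) h1x]
  have hu0 : 0 < x ^ H := rpow_pos_of_pos hx H
  have hu1 : x ^ H ≤ 1 := rpow_le_one hx.le (by linarith) hH0.le
  have hv0 : 0 < (1 - x) ^ H := rpow_pos_of_pos h1x H
  have hv1 : (1 - x) ^ H ≤ 1 := rpow_le_one h1x.le (by linarith) hH0.le
  have hv : 1 - x ≤ (1 - x) ^ H := self_le_rpow_of_le_one h1x.le (by linarith) hH1.le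
  have hw0 : 0 < (1 - q) ^ H := rpow_pos_of_pos (by linarith) H
  have hwv : (1 - q) ^ H ≤ (1 - x) ^ H := rpow_le_rpow (by linarith) (by linarith) hH0.le
  have hz1 : q ^ (1 - H) ≤ 1 := rpow_le_one hq0.le hq.le (by linarith)
  have hxz : x ≤ x ^ H * q ^ (1 - H) := by
    calc x = x ^ H * x ^ (1 - H) := by rw [← rpow_add hx]; simp
      _ ≤ x ^ H * q ^ (1 - H) := by gcongr
  generalize x ^ H = u at *
  generalize (1 - x) ^ H = v at *
  generalize (1 - q) ^ H = w at *
  generalize q ^ (1 - H) = z at *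
  have h1 : u * (1 - z) ≤ v + u - 1 := by linarith
  have h2 : w ≤ v + 1 - u := by linarith
  have h3 : u * (1 - z) * w ≤ (v + u - 1) * (v + 1 - u) :=
    mul_le_mul h1 h2 hw0.le ((mul_nonneg hu0.le (by linarith)).trans h1)
  have h4 : u ≤ u + (1 / 2) * (1 + u ^ 2 - v ^ 2) := by nlinarith
  have h5 : 0 ≤ u * (1 - z) * w := mul_nonneg (mul_nonneg hu0.le (by linarith)) hw0.le
  have h6 := mul_le_mul h3 h4 hu0.le (h5.trans h3)
  linarith [h6]

open Real in
/-- The covariance determinant of fractional Brownian motion at times `s` and `t` is bounded below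
by a multiple of `(s * t) ^ (2 * H)`, uniformly for `s / t` away from `1`. -/
lemma mul_rpow_le_fbm_det {H q s t : ℝ} (hH0 : 0 < H) (hH1 : H < 1) (hq : q < 1)
    (hs : 0 < s) (ht : 0 < t) (hst : s ≤ q * t) :
    (1 / 2) * (1 - q ^ (1 - H)) * (1 - q) ^ H * (s * t) ^ (2 * H) ≤
      (s * t) ^ (2 * H) -
        (1 / 4) * (t ^ (2 * H) + s ^ (2 * H) - (t - s) ^ (2 * H)) ^ 2 := by
  obtain ⟨x, rfl⟩ : ∃ x, s = x * t := ⟨s / t, by field_simp⟩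
  have hx : 0 < x := pos_of_mul_pos_left hs ht.le
  have hxq : x ≤ q := le_of_mul_le_mul_right hst ht
  have key := mul_le_mul_of_nonneg_right (mul_rpow_le_fbm_det_one hH0 hH1 hq hx hxq)
    (sq_nonneg (t ^ (2 * H)))
  rw [show t - x * t = (1 - x) * t by ring, mul_rpow hs.le ht.le, mul_rpow hx.le ht.le,
    mul_rpow (by linarith : (0 : ℝ) ≤ 1 - x) ht.le]
  linarith [key]

open Real in
lemma rpow_sub_rpow_sub_le {p s t : ℝ} (hp1 : p ≤ 1) (hs : 0 ≤ s) (hst : s < t) :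
    t ^ p - (t - s) ^ p ≤ s * t ^ (p - 1) := by
  have ht : 0 < t := hs.trans_lt hst
  have h1 : 0 ≤ 1 - s / t := by rw [sub_nonneg, div_le_one ht]; exact hst.le
  have h2 : 1 - s / t ≤ (1 - s / t) ^ p :=
    self_le_rpow_of_le_one h1 (by linarith [div_nonneg hs ht.le]) hp1
  have h3 : (t - s) ^ p = t ^ p * (1 - s / t) ^ p := by
    rw [← mul_rpow ht.le h1]; congr 1; field_simp
  have h4 := mul_le_mul_of_nonneg_left h2 (rpow_pos_of_pos ht p).le
  have h5 : s * t ^ (p - 1) = t ^ p * (s / t) := by rw [rpow_sub_one ht.ne']; ring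
  rw [h3, h5]
  linarith

open Real in
lemma abs_localTime_integrand_le {H q s t : ℝ} (hH : 1 / 2 < H) (hH1 : H < 1) (hq : q < 1)
    (hs : 0 < s) (ht : 0 < t) (hst : s ≤ q * t) :
    |(s ^ (2 * H - 1) + (t - s) ^ (2 * H - 1)) * (t ^ (2 * H - 1) - (t - s) ^ (2 * H - 1)) *
        ((s * t) ^ (2 * H) -
          (1 / 4) * (t ^ (2 * H) + s ^ (2 * H) - (t - s) ^ (2 * H)) ^ 2) ^ (-(1 : ℝ) / 2)| ≤
      2 * ((1 / 2) * (1 - q ^ (1 - H)) * (1 - q) ^ H) ^ (-(1 : ℝ) / 2) * s ^ (1 - H) *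
        t ^ (3 * H - 3) := by
  have hq0 : 0 < q := pos_of_mul_pos_left (hs.trans_le hst) ht.le
  have hlt : s < t := hst.trans_lt (by nlinarith)
  have hts : 0 < t - s := sub_pos.2 hlt
  have hc : 0 < (1 / 2) * (1 - q ^ (1 - H)) * (1 - q) ^ H := by
    have := rpow_lt_one hq0.le hq (by linarith : 0 < 1 - H)
    have := rpow_pos_of_pos (by linarith : 0 < 1 - q) H
    have : 0 < 1 - q ^ (1 - H) := by linarith
    positivity
  have hD := mul_rpow_le_fbm_det (by linarith : 0 < H) hH1 hq hs ht hst
  set c := (1 / 2) * (1 - q ^ (1 - H)) * (1 - q) ^ H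
  set D := (s * t) ^ (2 * H) - (1 / 4) * (t ^ (2 * H) + s ^ (2 * H) - (t - s) ^ (2 * H)) ^ 2
  have hm : 0 < c * (s * t) ^ (2 * H) := by positivity
  have hD3 : D ^ (-(1 : ℝ) / 2) ≤ c ^ (-(1 : ℝ) / 2) * (s ^ (-H) * t ^ (-H)) := by
    calc D ^ (-(1 : ℝ) / 2) ≤ (c * (s * t) ^ (2 * H)) ^ (-(1 : ℝ) / 2) :=
          rpow_le_rpow_of_nonpos hm hD (by norm_num)
      _ = c ^ (-(1 : ℝ) / 2) * (s ^ (-H) * t ^ (-H)) := by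
          rw [mul_rpow hc.le (by positivity), ← rpow_mul (by positivity),
            mul_rpow hs.le ht.le]
          ring_nf
  have hA : s ^ (2 * H - 1) + (t - s) ^ (2 * H - 1) ≤ 2 * t ^ (2 * H - 1) := by
    have h1 : s ^ (2 * H - 1) ≤ t ^ (2 * H - 1) := rpow_le_rpow hs.le hlt.le (by linarith)
    have h2 : (t - s) ^ (2 * H - 1) ≤ t ^ (2 * H - 1) :=
      rpow_le_rpow hts.le (by linarith) (by linarith)
    linarith
  have hB : t ^ (2 * H - 1) - (t - s) ^ (2 * H - 1) ≤ s * t ^ (2 * H - 1 - 1) :=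
    rpow_sub_rpow_sub_le (by linarith) hs.le hlt
  have hB0 : 0 ≤ t ^ (2 * H - 1) - (t - s) ^ (2 * H - 1) :=
    sub_nonneg.2 (rpow_le_rpow hts.le (by linarith) (by linarith))
  have hD0 : 0 ≤ D ^ (-(1 : ℝ) / 2) := rpow_nonneg (hm.le.trans hD) _
  rw [abs_of_nonneg (by positivity)]
  calc _ ≤ 2 * t ^ (2 * H - 1) * (s * t ^ (2 * H - 1 - 1)) *
        (c ^ (-(1 : ℝ) / 2) * (s ^ (-H) * t ^ (-H))) := by gcongr
    _ = 2 * c ^ (-(1 : ℝ) / 2) * (s * s ^ (-H)) *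
        (t ^ (2 * H - 1) * t ^ (2 * H - 1 - 1) * t ^ (-H)) := by ring
    _ = _ := by
      rw [← rpow_one_add' hs.le (by linarith), ← rpow_add ht, ← rpow_add ht]
      ring_nf


/-- For `H ∈ (1/2,1)` and `a > 0` there is `C > 0` such that for
every integer `n ≥ a + 2`,
`∫_a^{a+1} ∫_n^{n+1} (s^{2H−1}+(t−s)^{2H−1})(t^{2H−1}−(t−s)^{2H−1})·
((st)^{2H} − ¼(t^{2H}+s^{2H}−(t−s)^{2H})²)^{−1/2} dt ds ≤ C n^{3H−3}`. -/
theorem stmt10 (H a : ℝ) (hH : H ∈ Set.Ioo (1 / 2 : ℝ) 1) (ha : 0 < a) :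
    ∃ C : ℝ, 0 < C ∧ ∀ n : ℕ, a + 2 ≤ (n : ℝ) →
      (∫ s in a..(a + 1), ∫ t in (n : ℝ)..((n : ℝ) + 1),
          (s ^ (2 * H - 1) + (t - s) ^ (2 * H - 1)) *
            (t ^ (2 * H - 1) - (t - s) ^ (2 * H - 1)) *
              ((s * t) ^ (2 * H) -
                  (1 / 4) * (t ^ (2 * H) + s ^ (2 * H) - (t - s) ^ (2 * H)) ^ 2)
                ^ (-(1 : ℝ) / 2))
        ≤ C * (n : ℝ) ^ (3 * H - 3) := by
  obtain ⟨hH0, hH1⟩ := hH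
  set q : ℝ := (a + 1) / (a + 2)
  have hq0 : 0 < q := by positivity
  have hq : q < 1 := by rw [div_lt_one (by linarith)]; linarith
  set K : ℝ := 2 * ((1 / 2) * (1 - q ^ (1 - H)) * (1 - q) ^ H) ^ (-(1 : ℝ) / 2)
  have hK : 0 < K := by
    have := Real.rpow_lt_one hq0.le hq (by linarith : 0 < 1 - H)
    have : 0 < 1 - q ^ (1 - H) := by linarith
    have : 0 < 1 - q := by linarith
    positivity
  refine ⟨K * (a + 1) ^ (1 - H), by positivity, fun n hn => ?_⟩
  have hn0 : (0 : ℝ) < n := by linarith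
  refine (Real.le_norm_self _).trans ?_
  refine (intervalIntegral.norm_integral_le_of_norm_le_const
    (C := K * (a + 1) ^ (1 - H) * (n : ℝ) ^ (3 * H - 3)) fun s hs => ?_).trans_eq (by simp)
  rw [Set.uIoc_of_le (by linarith)] at hs
  have hs0 : 0 < s := ha.trans hs.1
  refine (intervalIntegral.norm_integral_le_of_norm_le_const
    (C := K * (a + 1) ^ (1 - H) * (n : ℝ) ^ (3 * H - 3)) fun t ht => ?_).trans_eq (by simp)
  rw [Set.uIoc_of_le (by linarith)] at ht
  have ht0 : 0 < t := hn0.trans ht.1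
  have hst : s ≤ q * t := by
    calc s ≤ a + 1 := hs.2
      _ = q * (a + 2) := by simp only [q]; field_simp
      _ ≤ q * t := by gcongr; linarith [ht.1]
  refine (abs_localTime_integrand_le hH0 hH1 hq hs0 ht0 hst).trans ?_
  have h1 : s ^ (1 - H) ≤ (a + 1) ^ (1 - H) := Real.rpow_le_rpow hs0.le hs.2 (by linarith)
  have h2 : t ^ (3 * H - 3) ≤ (n : ℝ) ^ (3 * H - 3) :=
    Real.rpow_le_rpow_of_nonpos hn0 ht.1.le (by linarith)
  change K * _ * _ ≤ _
  gcongr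
end

section
/- Let H ∈ (1/2, 1) and a > 0. Then there exist a constant c > 0 and N ∈ ℕ such that for every integer n ≥ N, ∫_n^{n+1} ∫_{a+2}^n ∫_a^{a+1} s₂^{−H} · t₂^{−H} · (t₁ − a − 1)^{2H−2} · (t₂ − a − 1)^{2H−2} ds₂ dt₁ dt₂ ≥ c · n^{3H−3}. (This lower bound on the covariance of increments is the key estimate showing that ∫_0^t sign(B_s) dB_s is long-range dependent when H ≥ 2/3.) -/
/-- If `f` is continuous on `[u, v]` and bounded below there by `m`, then `m (v - u) ≤ ∫_u^v f`. -/
theorem mul_sub_le_intervalIntegral {f : ℝ → ℝ} {u v m : ℝ} (huv : u ≤ v)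
    (hf : ContinuousOn f (Set.Icc u v)) (hm : ∀ x ∈ Set.Icc u v, m ≤ f x) :
    m * (v - u) ≤ ∫ x in u..v, f x := by
  have h := intervalIntegral.integral_mono_on (μ := MeasureTheory.volume) huv
    intervalIntegrable_const (hf.intervalIntegrable_of_Icc huv) hm
  rwa [intervalIntegral.integral_const, smul_eq_mul, mul_comm] at h


/-- For `H ∈ (1/2,1)` and `a > 0` there are `c > 0` and `N` such
that for all integers `n ≥ N`,
`∫_n^{n+1} ∫_{a+2}^n ∫_a^{a+1} s₂^{−H} t₂^{−H} (t₁−a−1)^{2H−2} (t₂−a−1)^{2H−2}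
 ds₂ dt₁ dt₂ ≥ c n^{3H−3}`. -/
theorem stmt11 (H a : ℝ) (hH : H ∈ Set.Ioo (1 / 2 : ℝ) 1) (ha : 0 < a) :
    ∃ c : ℝ, 0 < c ∧ ∃ N : ℕ, ∀ n : ℕ, N ≤ n →
      c * (n : ℝ) ^ (3 * H - 3)
        ≤ ∫ t₂ in (n : ℝ)..((n : ℝ) + 1), ∫ t₁ in (a + 2)..(n : ℝ),
            ∫ s₂ in a..(a + 1),
              s₂ ^ (-H) * t₂ ^ (-H) *
                (t₁ - a - 1) ^ (2 * H - 2) * (t₂ - a - 1) ^ (2 * H - 2) := by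
  obtain ⟨hH1, hH2⟩ := hH
  set A : ℝ := ∫ s in a..(a + 1), s ^ (-H) with hA
  have hA_pos : 0 < A := by
    have h := mul_sub_le_intervalIntegral (f := fun s => s ^ (-H)) (u := a) (v := a + 1)
      (m := (a + 1) ^ (-H)) (by linarith)
      (continuousOn_id.rpow_const fun x hx => Or.inl (ha.trans_le hx.1).ne')
      (fun x hx => Real.rpow_le_rpow_of_nonpos (ha.trans_le hx.1) hx.2 (by linarith))
    rw [add_sub_cancel_left, mul_one] at h
    exact (Real.rpow_pos_of_pos (by linarith) _).trans_le h
  obtain ⟨N, hN⟩ := exists_nat_ge (2 * (a + 2))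
  refine ⟨A * 2 ^ (-H) * (1 / 2), by positivity, N, fun n hn => ?_⟩
  have hNn : 2 * (a + 2) ≤ (n : ℝ) := hN.trans (by exact_mod_cast hn)
  have hn_pos : (0 : ℝ) < n := by linarith
  simp only [intervalIntegral.integral_mul_const, intervalIntegral.integral_const_mul, ← hA]
  set B : ℝ := ∫ t in (a + 2)..(n : ℝ), (t - a - 1) ^ (2 * H - 2)
  have hB_lower : (n : ℝ) ^ (2 * H - 2) * (n / 2) ≤ B := by
    refine le_trans ?_ (mul_sub_le_intervalIntegral (m := (n : ℝ) ^ (2 * H - 2))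
      (by linarith) ?_ ?_)
    · gcongr
      linarith
    · refine ContinuousOn.rpow_const (by fun_prop) fun x hx => Or.inl ?_
      linarith [hx.1]
    · intro x hx
      exact Real.rpow_le_rpow_of_nonpos (by linarith [hx.1]) (by linarith [hx.2]) (by linarith)
  have hB_nonneg : 0 ≤ B := le_trans (by positivity) hB_lower
  have h_exp : (n : ℝ) ^ (3 * H - 3)
      = (n : ℝ) ^ (-H) * ((n : ℝ) ^ (2 * H - 2) * n) * (n : ℝ) ^ (2 * H - 2) := by
    nth_rewrite 4 [← Real.rpow_one (n : ℝ)]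
    rw [← Real.rpow_add hn_pos, ← Real.rpow_add hn_pos, ← Real.rpow_add hn_pos]
    ring_nf
  have h_lower := mul_sub_le_intervalIntegral
    (f := fun t => A * t ^ (-H) * B * (t - a - 1) ^ (2 * H - 2)) (u := n) (v := n + 1)
    (m := A * (2 * n : ℝ) ^ (-H) * ((n : ℝ) ^ (2 * H - 2) * (n / 2)) * (n : ℝ) ^ (2 * H - 2))
    (by linarith)
    (by
      refine ((continuousOn_const.mul ?_).mul continuousOn_const).mul ?_
      · exact continuousOn_id.rpow_const fun x hx => Or.inl (hn_pos.trans_le hx.1).ne'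
      · refine ContinuousOn.rpow_const (by fun_prop) fun x hx => Or.inl ?_
        linarith [hx.1])
    (by
      intro t ht
      have ht_pos : 0 < t := hn_pos.trans_le ht.1
      have h_left : (2 * n : ℝ) ^ (-H) ≤ t ^ (-H) :=
        Real.rpow_le_rpow_of_nonpos ht_pos (by linarith [ht.2]) (by linarith)
      have h_right : (n : ℝ) ^ (2 * H - 2) ≤ (t - a - 1) ^ (2 * H - 2) :=
        Real.rpow_le_rpow_of_nonpos (by linarith [ht.1]) (by linarith [ht.2]) (by linarith)
      gcongr)
  rw [add_sub_cancel_left, mul_one] at h_lower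
  refine le_trans (le_of_eq ?_) h_lower
  rw [h_exp, Real.mul_rpow zero_le_two hn_pos.le]
  ring
end
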